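/- For any nonzero c ∈ ℤ_{≥0}^n and any ε with 0 < ε < 1/2, one has L_c(ε) ≤ n/ε; that is, there exists an x*(ε)-critical vector c̃ ∈ ℤ_{≥0}^n with ‖c̃‖₁ ≤ n/ε. -/

import Mathlib

open Finset

/-- The point `x*(ε) = (1/2+ε, …, 1/2+ε)`. -/
noncomputable def xstar (n : ℕ) (ε : ℝ) : Fin n → ℝ := fun _ => 1 / 2 + ε

/-- `K(c) = {x ∈ {0,1}ⁿ : c·x ≤ ‖c‖₁/2}`. -/
def Kset {n : ℕ} (c : Fin n → ℤ) : Set (Fin n → ℝ) :=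
  {x | (∀ i, x i = 0 ∨ x i = 1) ∧ ∑ i, (c i : ℝ) * x i ≤ (∑ i, |(c i : ℝ)|) / 2}

/-- `c̃` is `x*(ε)`-critical: `c̃·x*(ε) ≥ max{c̃·x : x ∈ K(c)}`. -/
def IsCritical {n : ℕ} (c : Fin n → ℤ) (ε : ℝ) (ct : Fin n → ℤ) : Prop :=
  ∀ x ∈ Kset c, ∑ i, (ct i : ℝ) * x i ≤ ∑ i, (ct i : ℝ) * xstar n ε i

/-- Rounding down the multiple of `c` of `ℓ¹`-norm `n/ε` gives a nonzero critical vector. -/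
theorem exists_ne_zero_isCritical (n : ℕ) (c : Fin n → ℤ) (hc : ∀ i, 0 ≤ c i) (hc0 : c ≠ 0)
    (ε : ℝ) (hε0 : 0 < ε) (hε : ε < 1 / 2) :
    ∃ ct : Fin n → ℤ, ct ≠ 0 ∧ (∀ i, 0 ≤ ct i) ∧ IsCritical c ε ct ∧
      (∑ i, |(ct i : ℝ)|) ≤ (n : ℝ) / ε := by
  have hcR : ∀ i, (0 : ℝ) ≤ c i := fun i => by exact_mod_cast hc i
  obtain ⟨j, hj⟩ := Function.ne_iff.mp hc0
  have hn : (0 : ℝ) < n := by exact_mod_cast Fin.pos j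
  have hS : 0 < ∑ i, (c i : ℝ) :=
    sum_pos' (fun i _ => hcR i)
      ⟨j, mem_univ j, (hcR j).lt_of_ne' (by exact_mod_cast hj)⟩
  set t : ℝ := n / ε / ∑ i, (c i : ℝ) with ht
  have ht0 : 0 < t := by positivity
  have hsum : ∑ i, t * (c i : ℝ) = n / ε := by
    rw [← mul_sum, ht, div_mul_cancel₀ _ hS.ne']
  have hle : ∀ i, (⌊t * (c i : ℝ)⌋ : ℝ) ≤ t * c i := fun i => Int.floor_le _
  have hnonneg : ∀ i, 0 ≤ ⌊t * (c i : ℝ)⌋ := fun i =>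
    Int.floor_nonneg.mpr (mul_nonneg ht0.le (hcR i))
  have hlower : (n : ℝ) / ε - n ≤ ∑ i, (⌊t * (c i : ℝ)⌋ : ℝ) := by
    calc (n : ℝ) / ε - n = ∑ i, (t * (c i : ℝ) - 1) := by
          rw [sum_sub_distrib, hsum]; simp
      _ ≤ _ := sum_le_sum fun i _ => (Int.sub_one_lt_floor _).le
  have hhalf : (n : ℝ) / 2 ≤ ε * ∑ i, (⌊t * (c i : ℝ)⌋ : ℝ) := by
    calc (n : ℝ) / 2 ≤ n - ε * n := by nlinarith
      _ = ε * (n / ε - n) := by field_simp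
      _ ≤ _ := mul_le_mul_of_nonneg_left hlower hε0.le
  refine ⟨fun i => ⌊t * (c i : ℝ)⌋, fun h0 => ?_, hnonneg, ?_, ?_⟩
  · have hz : ∑ i, (⌊t * (c i : ℝ)⌋ : ℝ) = 0 :=
      sum_eq_zero fun i _ => by exact_mod_cast congrFun h0 i
    rw [hz] at hhalf
    linarith
  · rintro x ⟨hx, hcx⟩
    simp only [abs_of_nonneg (hcR _)] at hcx
    have hround : ∀ i, (⌊t * (c i : ℝ)⌋ : ℝ) * x i - ⌊t * (c i : ℝ)⌋ * (1 / 2) ≤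
        t * (c i * x i - c i / 2) + 1 / 2 := fun i => by
      have := hle i
      have := Int.sub_one_lt_floor (t * (c i : ℝ))
      rcases hx i with h | h <;> rw [h] <;> linarith
    have htotal := sum_le_sum fun i (_ : i ∈ univ) => hround i
    rw [sum_sub_distrib, sum_add_distrib, ← mul_sum, sum_sub_distrib, ← sum_div,
      ← sum_mul] at htotal
    simp only [sum_const, card_univ, Fintype.card_fin, nsmul_eq_mul] at htotal
    have := mul_nonpos_of_nonneg_of_nonpos ht0.le (sub_nonpos.mpr hcx)
    simp only [xstar, ← sum_mul]
    linarith
  · rw [← hsum]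
    refine sum_le_sum fun i _ => ?_
    rw [abs_of_nonneg (by exact_mod_cast hnonneg i)]
    exact hle i

/-- Upper bound `L_c(ε) ≤ n/ε`: for any nonzero `c ∈ ℤ_{≥0}ⁿ` and `0 < ε < 1/2`, there
is an `x*(ε)`-critical vector `c̃ ∈ ℤ_{≥0}ⁿ` with `‖c̃‖₁ ≤ n/ε`. -/
theorem L_upper_bound (n : ℕ) (c : Fin n → ℤ) (hc : ∀ i, 0 ≤ c i) (hc0 : c ≠ 0)
    (ε : ℝ) (hε0 : 0 < ε) (hε : ε < 1 / 2) :
    ∃ ct : Fin n → ℤ, (∀ i, 0 ≤ ct i) ∧ IsCritical c ε ct ∧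
      (∑ i, |(ct i : ℝ)|) ≤ (n : ℝ) / ε := by
  obtain ⟨ct, -, h⟩ := exists_ne_zero_isCritical n c hc hc0 ε hε0 hε
  exact ⟨ct, h⟩
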